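/- Let (H, α, β, ·, Δ, ε) be a Hopf algebroid over R and suppose F = F₁⊗_R F₂ ∈ H⊗_R H satisfies (T1) (Δ⊗_R id)(F)·(F⊗_R 1) = (id⊗_R Δ)(F)·(1⊗_R F) in H^{⊗_R 3} and (T2) (ε⊗_R id)F = (id⊗_R ε)F = 1. Then the operation a ⋆_F b := (F₁▷a)(F₂▷b) on R is well defined (independent of the finite sum representing F in H⊗_R H), and R_F := (R, ⋆_F) is an associative K-algebra with unit 1. -/

import Mathlib

/-! # Preliminaries: Hopf algebroids in the sense of Xu

We fix a field `K` of characteristic zero, an associative unital `K`-algebra `R` and an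
associative unital `K`-algebra `H`.  We construct the `n`-fold tensor powers
`H^{⊗_K n}` of `H` over `K` and, given source and target maps `α, β : R → H`, the
quotients `H^{⊗_R n}` of `H^{⊗_K n}` by the right ideal `I_n` generated by the elements
`1 ⊗ ⋯ ⊗ β(r) ⊗ 1 ⊗ ⋯ ⊗ 1 − 1 ⊗ ⋯ ⊗ 1 ⊗ α(r) ⊗ ⋯ ⊗ 1`.

A Hopf algebroid is then given by the data `(H, α, β, ·, Δ, ε)` subject to the axioms of
Xu; the iterated coproducts `Δⁿ = (Δ^{n−1} ⊗_R id) ∘ Δ` are part of the data, uniquely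
characterized by their recursion.  All axioms involving maps induced on the quotients
`H^{⊗_R n}` are stated equivalently in terms of (arbitrary) lifts along the quotient
maps and (arbitrary) presentations of elements as sums of pure tensors. -/

noncomputable section

open scoped TensorProduct

universe u

variable (K : Type u) [Field K] [CharZero K]

/-- A bundled associative unital `K`-algebra. -/
structure BAlg : Type (u + 1) where
  carrier : Type u
  [isRing : Ring carrier]
  [isAlgebra : Algebra K carrier]

attribute [instance] BAlg.isRing BAlg.isAlgebra

instance : CoeSort (BAlg K) (Type u) := ⟨BAlg.carrier⟩

variable (H : Type u) [Ring H] [Algebra K H]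

/-- The `n`-fold tensor power `H^{⊗_K n}` of `H` over `K` (with `H^{⊗_K 0} = K` and
`H^{⊗_K 1} = H`), as a bundled `K`-algebra. -/
def TPa : ℕ → BAlg K
  | 0 => ⟨K⟩
  | 1 => ⟨H⟩
  | (n + 2) => ⟨(TPa (n + 1)) ⊗[K] H⟩

/-- The `n`-fold tensor power `H^{⊗_K n}`. -/
abbrev TP (n : ℕ) : Type u := TPa K H n

/-- The element of `H^{⊗_K n}` with `h` in slot `i` (`0`-indexed) and `1` in all other
slots. -/
def slotP : (n : ℕ) → ℕ → H → TP K H n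
  | 0, _, _ => 1
  | 1, _, h => h
  | (n + 2), i, h =>
      if i = n + 1 then ((1 : TP K H (n + 1)) ⊗ₜ[K] h : TP K H (n + 1) ⊗[K] H)
      else ((slotP (n + 1) i h) ⊗ₜ[K] (1 : H) : TP K H (n + 1) ⊗[K] H)

/-- The pure tensor `x₀ ⊗ x₁ ⊗ ⋯ ⊗ x_{n-1} ∈ H^{⊗_K n}`, written as the product of its
slot components. -/
def chainP (n : ℕ) (x : Fin n → H) : TP K H n :=
  (List.ofFn (fun i : Fin n => slotP K H n (i : ℕ) (x i))).prod

variable {R : Type u} [Ring R] [Algebra K R]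

/-- The relator `1 ⊗ ⋯ ⊗ β(r) ⊗ 1 ⊗ ⋯ ⊗ 1 − 1 ⊗ ⋯ ⊗ 1 ⊗ α(r) ⊗ ⋯ ⊗ 1` with `β(r)` in
slot `i` and `α(r)` in slot `i + 1` (`0`-indexed). -/
def relator (αf βf : R → H) (n : ℕ) (r : R) (i : ℕ) : TP K H n :=
  slotP K H n i (βf r) - slotP K H n (i + 1) (αf r)

/-- The right ideal `I_n ⊆ H^{⊗_K n}` generated by the relators. -/
def Idl (αf βf : R → H) (n : ℕ) : Submodule K (TP K H n) :=
  Submodule.span K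
    {z | ∃ (r : R) (i : ℕ) (x : TP K H n), i + 2 ≤ n ∧ z = relator K H αf βf n r i * x}

/-- The `n`-fold tensor power `H^{⊗_R n} := H^{⊗_K n} / I_n` of `H` over `R`
(`H^{⊗_R 1} = H` and, by convention, `H^{⊗_R 0} = R` is treated separately). -/
abbrev QT (αf βf : R → H) (n : ℕ) : Type u := TP K H n ⧸ Idl K H αf βf n

/-- The quotient map `H^{⊗_K n} → H^{⊗_R n}`. -/
abbrev qtMk (αf βf : R → H) (n : ℕ) : TP K H n →ₗ[K] QT K H αf βf n :=
  (Idl K H αf βf n).mkQ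

variable (R)

/-- A Hopf algebroid `(H, α, β, ·, Δ, ε)` over `R`, in the sense of Xu, together with its
(uniquely characterized) iterated coproducts `Δⁿ`.  The source map `α` (an algebra
homomorphism) and the target map `β` (an algebra anti-homomorphism) are taken as
parameters.  All conditions on elements of the quotients `H^{⊗_R n}` are expressed via
arbitrary lifts along the quotient maps. -/
structure HopfAlgebroid (α : R →ₐ[K] H) (β : R →ₗ[K] H) : Type u where
  β_one : β 1 = 1
  /-- `β` is an algebra anti-homomorphism -/
  β_mul : ∀ a b : R, β (a * b) = β b * β a
  /-- the images of `α` and `β` commute -/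
  αβ_comm : ∀ a b : R, α a * β b = β b * α a
  /-- the coproduct -/
  Δ : H →ₗ[K] QT K H (fun a => α a) (fun a => β a) 2
  Δ_one : Δ 1 = qtMk K H (fun a => α a) (fun a => β a) 2 1
  /-- `Δ(x) · (β(a) ⊗ 1 − 1 ⊗ α(a)) = 0` -/
  Δ_compat : ∀ (x : H) (a : R) (s : TP K H 2),
    qtMk K H (fun a => α a) (fun a => β a) 2 s = Δ x →
    qtMk K H (fun a => α a) (fun a => β a) 2
      (s * relator K H (fun a => α a) (fun a => β a) 2 a 0) = 0
  /-- `Δ(x₁ x₂) = Δ(x₁) · Δ(x₂)` -/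
  Δ_mul : ∀ (x y : H) (s t : TP K H 2),
    qtMk K H (fun a => α a) (fun a => β a) 2 s = Δ x →
    qtMk K H (fun a => α a) (fun a => β a) 2 t = Δ y →
    Δ (x * y) = qtMk K H (fun a => α a) (fun a => β a) 2 (s * t)
  /-- `Δ` is a morphism of `(R,R)`-bimodules, left action -/
  Δ_bimod_left : ∀ (a : R) (x : H) (s : TP K H 2),
    qtMk K H (fun a => α a) (fun a => β a) 2 s = Δ x →
    Δ (α a * x) = qtMk K H (fun a => α a) (fun a => β a) 2 (slotP K H 2 0 (α a) * s)
  /-- `Δ` is a morphism of `(R,R)`-bimodules, right action -/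
  Δ_bimod_right : ∀ (a : R) (x : H) (s : TP K H 2),
    qtMk K H (fun a => α a) (fun a => β a) 2 s = Δ x →
    Δ (β a * x) = qtMk K H (fun a => α a) (fun a => β a) 2 (slotP K H 2 1 (β a) * s)
  /-- coassociativity `(Δ ⊗_R id) ∘ Δ = (id ⊗_R Δ) ∘ Δ` -/
  coassoc : ∀ (x : H) (C : ℕ) (uu vv : Fin C → H),
    qtMk K H (fun a => α a) (fun a => β a) 2 (∑ c, (uu c ⊗ₜ[K] vv c : TP K H 2)) = Δ x →
    ∀ s t : Fin C → TP K H 2,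
      (∀ c, qtMk K H (fun a => α a) (fun a => β a) 2 (s c) = Δ (uu c)) →
      (∀ c, qtMk K H (fun a => α a) (fun a => β a) 2 (t c) = Δ (vv c)) →
      qtMk K H (fun a => α a) (fun a => β a) 3 (∑ c, (s c ⊗ₜ[K] vv c : TP K H 3)) =
        qtMk K H (fun a => α a) (fun a => β a) 3
          (∑ c, (TensorProduct.assoc K H H H).symm (uu c ⊗ₜ[K] t c))
  /-- the counit -/
  ε : H →ₗ[K] R
  ε_one : ε 1 = 1
  ε_bimod_left : ∀ (a : R) (x : H), ε (α a * x) = a * ε x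
  ε_bimod_right : ∀ (a : R) (x : H), ε (β a * x) = ε x * a
  /-- `(ε ⊗_R id) ∘ Δ = id` -/
  counit_left : ∀ (x : H) (C : ℕ) (uu vv : Fin C → H),
    qtMk K H (fun a => α a) (fun a => β a) 2 (∑ c, (uu c ⊗ₜ[K] vv c : TP K H 2)) = Δ x →
    ∑ c, α (ε (uu c)) * vv c = x
  /-- `(id ⊗_R ε) ∘ Δ = id` -/
  counit_right : ∀ (x : H) (C : ℕ) (uu vv : Fin C → H),
    qtMk K H (fun a => α a) (fun a => β a) 2 (∑ c, (uu c ⊗ₜ[K] vv c : TP K H 2)) = Δ x →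
    ∑ c, β (ε (vv c)) * uu c = x
  /-- `ker ε` is a left ideal of `H` -/
  ker_ε_ideal : ∀ x y : H, ε y = 0 → ε (x * y) = 0
  /-- the iterated coproducts `Δⁿ : H → H^{⊗_R (n+1)}` -/
  Δpow : ∀ n : ℕ, H →ₗ[K] QT K H (fun a => α a) (fun a => β a) (n + 1)
  Δpow_zero : ∀ x : H, Δpow 0 x = qtMk K H (fun a => α a) (fun a => β a) 1 x
  Δpow_one : Δpow 1 = Δ
  /-- `Δ^{n+1} = (Δⁿ ⊗_R id) ∘ Δ` -/
  Δpow_succ : ∀ (n : ℕ) (x : H) (C : ℕ) (uu vv : Fin C → H),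
    qtMk K H (fun a => α a) (fun a => β a) 2 (∑ c, (uu c ⊗ₜ[K] vv c : TP K H 2)) = Δ x →
    ∀ s : Fin C → TP K H (n + 1),
      (∀ c, qtMk K H (fun a => α a) (fun a => β a) (n + 1) (s c) = Δpow n (uu c)) →
      Δpow (n + 1) x =
        qtMk K H (fun a => α a) (fun a => β a) (n + 2)
          (∑ c, (s c ⊗ₜ[K] vv c : TP K H (n + 2)))

namespace HopfAlgebroid

variable {K H R}
variable {α : R →ₐ[K] H} {β : R →ₗ[K] H} (D : HopfAlgebroid K H R α β)

/-- The left `H`-module structure `h ▷ a := ε(h · α(a))` on `R`. -/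
def hAct (h : H) (a : R) : R := D.ε (h * α a)

end HopfAlgebroid
/-! ### Twistor-type elements: common definitions -/

section TwistorBasics

variable {K : Type u} [Field K] [CharZero K]
variable {H : Type u} [Ring H] [Algebra K H]
variable {R : Type u} [Ring R] [Algebra K R]
variable {α : R →ₐ[K] H} {β : R →ₗ[K] H}

/-- Given a presentation `F = Σ_c (p c) ⊗_R (q c)` of an element of `H ⊗_R H`, the
induced product `a ⋆_F b := (F₁ ▷ a) · (F₂ ▷ b)` on `R`. -/
def starF (D : HopfAlgebroid K H R α β) {C : ℕ} (p q : Fin C → H) (a b : R) : R :=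
  ∑ c, D.hAct (p c) a * D.hAct (q c) b

/-- The twisted source map `α_F(a) := α(F₁ ▷ a) · F₂`. -/
def alphaF (D : HopfAlgebroid K H R α β) {C : ℕ} (p q : Fin C → H) (a : R) : H :=
  ∑ c, α (D.hAct (p c) a) * q c

/-- The twisted target map `β_F(a) := β(F₂ ▷ a) · F₁`. -/
def betaF (D : HopfAlgebroid K H R α β) {C : ℕ} (p q : Fin C → H) (a : R) : H :=
  ∑ c, β (D.hAct (q c) a) * p c

/-- The twistor equation (T1):
`(Δ ⊗_R id)(F) · (F ⊗_R 1) = (id ⊗_R Δ)(F) · (1 ⊗_R F)` in `H^{⊗_R 3}`, expressed via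
a presentation `F = Σ_c (p c) ⊗_R (q c)` and lifts `s c`, `t c` of `Δ(p c)`, `Δ(q c)`. -/
def TwistorEq1 (D : HopfAlgebroid K H R α β) {C : ℕ} (p q : Fin C → H)
    (s t : Fin C → TP K H 2) : Prop :=
  qtMk K H (fun a => α a) (fun a => β a) 3
      ((∑ c, (s c ⊗ₜ[K] q c : TP K H 3)) *
        (∑ c, ((p c ⊗ₜ[K] q c : TP K H 2) ⊗ₜ[K] (1 : H) : TP K H 3))) =
    qtMk K H (fun a => α a) (fun a => β a) 3
      ((∑ c, (TensorProduct.assoc K H H H).symm (p c ⊗ₜ[K] t c)) *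
        (∑ c, (TensorProduct.assoc K H H H).symm ((1 : H) ⊗ₜ[K] (p c ⊗ₜ[K] q c : TP K H 2))))

/-- The counit condition (T2): `(ε ⊗_R id)F = (id ⊗_R ε)F = 1`. -/
def TwistorEq2 (D : HopfAlgebroid K H R α β) {C : ℕ} (p q : Fin C → H) : Prop :=
  (∑ c, α (D.ε (p c)) * q c = 1) ∧ (∑ c, β (D.ε (q c)) * p c = 1)

end TwistorBasics
/-! ### STATEMENT 9 -/

section Aux9

variable {K : Type u} [Field K] [CharZero K]
variable {H : Type u} [Ring H] [Algebra K H]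
variable {R : Type u} [Ring R] [Algebra K R]
variable {α : R →ₐ[K] H} {β : R →ₗ[K] H}

theorem aux9_eps_α (D : HopfAlgebroid K H R α β) (a : R) : D.ε (α a) = a := by
  have := D.ε_bimod_left a 1
  rwa [mul_one, D.ε_one, mul_one] at this

theorem aux9_eps_mul (D : HopfAlgebroid K H R α β) (x y : H) :
    D.ε (x * y) = D.ε (x * α (D.ε y)) := by
  have := D.ker_ε_ideal x (y - α (D.ε y)) (by rw [map_sub, aux9_eps_α, sub_self])
  rwa [mul_sub, map_sub, sub_eq_zero] at this

theorem aux9_act_mul (D : HopfAlgebroid K H R α β) (x y : H) (a : R) :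
    D.hAct (x * y) a = D.hAct x (D.hAct y a) := by
  unfold HopfAlgebroid.hAct
  rw [mul_assoc, aux9_eps_mul]

theorem aux9_act_one (D : HopfAlgebroid K H R α β) (a : R) : D.hAct 1 a = a := by
  unfold HopfAlgebroid.hAct
  rw [one_mul, aux9_eps_α]

theorem aux9_act_α (D : HopfAlgebroid K H R α β) (r : R) (x : H) (a : R) :
    D.hAct (α r * x) a = r * D.hAct x a := by
  unfold HopfAlgebroid.hAct
  rw [mul_assoc, D.ε_bimod_left]

theorem aux9_act_β (D : HopfAlgebroid K H R α β) (r : R) (x : H) (a : R) :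
    D.hAct (β r * x) a = D.hAct x a * r := by
  unfold HopfAlgebroid.hAct
  rw [mul_assoc, D.ε_bimod_right]

/-- the action as a linear map in `h` -/
def act9 (D : HopfAlgebroid K H R α β) (a : R) : H →ₗ[K] R :=
  D.ε ∘ₗ LinearMap.mulRight K (α a)

theorem act9_apply (D : HopfAlgebroid K H R α β) (a : R) (h : H) :
    act9 D a h = D.hAct h a := rfl

theorem aux9_act_sum (D : HopfAlgebroid K H R α β) {ι : Type*} (S : Finset ι) (h : H)
    (f : ι → R) : D.hAct h (∑ i ∈ S, f i) = ∑ i ∈ S, D.hAct h (f i) := by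
  unfold HopfAlgebroid.hAct
  rw [map_sum, Finset.mul_sum, map_sum]

/-- `x ⊗ y` -/
def tt9 (K : Type u) [Field K] {H : Type u} [Ring H] [Algebra K H] (x y : H) : TP K H 2 :=
  (x ⊗ₜ[K] y : H ⊗[K] H)

/-- `x ⊗ z` -/
def ttt9 {K : Type u} [Field K] {H : Type u} [Ring H] [Algebra K H] (x : TP K H 2) (z : H) :
    TP K H 3 :=
  (x ⊗ₜ[K] z : TP K H 2 ⊗[K] H)

/-- `x ⊗ z` reassociated -/
def as9 {K : Type u} [Field K] {H : Type u} [Ring H] [Algebra K H] (x : H) (z : TP K H 2) :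
    TP K H 3 :=
  ((TensorProduct.assoc K H H H).symm (x ⊗ₜ[K] (z : H ⊗[K] H)) : (H ⊗[K] H) ⊗[K] H)

/-- `x ⊗ y ↦ (x ▷ a)(y ▷ b)` -/
def mu9 (D : HopfAlgebroid K H R α β) (a b : R) : TP K H 2 →ₗ[K] R :=
  (LinearMap.mul' K R ∘ₗ TensorProduct.map (act9 D a) (act9 D b) : H ⊗[K] H →ₗ[K] R)

theorem mu9_tmul (D : HopfAlgebroid K H R α β) (a b : R) (x y : H) :
    mu9 D a b (tt9 K x y) = D.hAct x a * D.hAct y b := rfl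

/-- `x ⊗ y ⊗ z ↦ (x ▷ a)(y ▷ b)(z ▷ c)` -/
def phi9 (D : HopfAlgebroid K H R α β) (a b c : R) : TP K H 3 →ₗ[K] R :=
  (LinearMap.mul' K R ∘ₗ TensorProduct.map (mu9 D a b) (act9 D c) :
    TP K H 2 ⊗[K] H →ₗ[K] R)

theorem phi9_tmul (D : HopfAlgebroid K H R α β) (a b c : R) (x : TP K H 2) (z : H) :
    phi9 D a b c (ttt9 x z) = mu9 D a b x * D.hAct z c := rfl

theorem mul9_two (x y x' y' : H) : tt9 K x y * tt9 K x' y' = tt9 K (x * x') (y * y') :=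
  Algebra.TensorProduct.tmul_mul_tmul x x' y y'

theorem mul9_three (x x' : TP K H 2) (y y' : H) :
    ttt9 x y * ttt9 x' y' = ttt9 (x * x') (y * y') :=
  Algebra.TensorProduct.tmul_mul_tmul x x' y y'

theorem ind9_two {P : TP K H 2 → Prop} (h0 : P 0)
    (ht : ∀ x y : H, P (tt9 K x y)) (ha : ∀ x y, P x → P y → P (x + y)) (z : TP K H 2) : P z := by
  have : ∀ z : H ⊗[K] H, P z := fun z => by
    induction z using TensorProduct.induction_on with
    | zero => exact h0
    | tmul x y => exact ht x y
    | add x y hx hy => exact ha x y hx hy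
  exact this z

theorem ind9_three {P : TP K H 3 → Prop} (h0 : P 0)
    (ht : ∀ (x : TP K H 2) (y : H), P (ttt9 x y))
    (ha : ∀ x y, P x → P y → P (x + y)) (z : TP K H 3) : P z := by
  have : ∀ z : TP K H 2 ⊗[K] H, P z := fun z => by
    induction z using TensorProduct.induction_on with
    | zero => exact h0
    | tmul x y => exact ht x y
    | add x y hx hy => exact ha x y hx hy
  exact this z

theorem slot9_20 (h : H) : slotP K H 2 0 h = tt9 K h 1 := rfl
theorem slot9_21 (h : H) : slotP K H 2 1 h = tt9 K 1 h := rfl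
theorem slot9_30 (h : H) : slotP K H 3 0 h = ttt9 (slotP K H 2 0 h) 1 := rfl
theorem slot9_31 (h : H) : slotP K H 3 1 h = ttt9 (slotP K H 2 1 h) 1 := rfl
theorem slot9_32 (h : H) : slotP K H 3 2 h = ttt9 1 h := rfl

theorem mu9_slot (D : HopfAlgebroid K H R α β) (a b r : R) (x : TP K H 2) :
    mu9 D a b (slotP K H 2 0 (β r) * x) = mu9 D a b (slotP K H 2 1 (α r) * x) := by
  induction x using ind9_two with
  | h0 => simp only [mul_zero]
  | ha x y hx hy => rw [mul_add, mul_add, map_add, map_add, hx, hy]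
  | ht x y =>
  rw [slot9_20, slot9_21, mul9_two, mul9_two, mu9_tmul, mu9_tmul, one_mul, one_mul,
    aux9_act_α, aux9_act_β, mul_assoc]

theorem mu9_slot_right (D : HopfAlgebroid K H R α β) (a b r : R) (x : TP K H 2) :
    mu9 D a b (slotP K H 2 1 (β r) * x) = mu9 D a b x * r := by
  induction x using ind9_two with
  | h0 => simp only [mul_zero, map_zero, zero_mul]
  | ha x y hx hy => rw [mul_add, map_add, map_add, hx, hy, add_mul]
  | ht x y =>
  rw [slot9_21, mul9_two, mu9_tmul, mu9_tmul, one_mul, aux9_act_β, mul_assoc]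

theorem mu9_Idl (D : HopfAlgebroid K H R α β) (a b : R) :
    Idl K H (fun a => α a) (fun a => β a) 2 ≤ LinearMap.ker (mu9 D a b) := by
  refine Submodule.span_le.2 ?_
  rintro z ⟨r, i, x, hi, rfl⟩
  obtain rfl : i = 0 := by omega
  rw [SetLike.mem_coe, LinearMap.mem_ker, relator, sub_mul, map_sub, sub_eq_zero]
  exact mu9_slot D a b r x

theorem phi9_Idl (D : HopfAlgebroid K H R α β) (a b c : R) :
    Idl K H (fun a => α a) (fun a => β a) 3 ≤ LinearMap.ker (phi9 D a b c) := by
  refine Submodule.span_le.2 ?_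
  rintro z ⟨r, i, x, hi, rfl⟩
  rw [SetLike.mem_coe, LinearMap.mem_ker, relator, sub_mul, map_sub, sub_eq_zero]
  induction x using ind9_three with
  | h0 => simp only [mul_zero]
  | ha x y hx hy => rw [mul_add, mul_add, map_add, map_add, hx, hy]
  | ht x y =>
  obtain rfl | rfl : i = 0 ∨ i = 1 := by omega
  · rw [slot9_30, slot9_31, mul9_three, mul9_three, phi9_tmul, phi9_tmul, mu9_slot]
  · rw [slot9_31, slot9_32, mul9_three, mul9_three, phi9_tmul, phi9_tmul, mu9_slot_right,
      one_mul, one_mul, aux9_act_α, mul_assoc]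

theorem mu9_congr (D : HopfAlgebroid K H R α β) (a b : R) (x y : TP K H 2)
    (h : qtMk K H (fun a => α a) (fun a => β a) 2 x = qtMk K H (fun a => α a) (fun a => β a) 2 y) :
    mu9 D a b x = mu9 D a b y := by
  have h1 := mu9_Idl D a b ((Submodule.Quotient.eq _).1 h)
  rwa [LinearMap.mem_ker, map_sub, sub_eq_zero] at h1

theorem phi9_congr (D : HopfAlgebroid K H R α β) (a b c : R) (x y : TP K H 3)
    (h : qtMk K H (fun a => α a) (fun a => β a) 3 x = qtMk K H (fun a => α a) (fun a => β a) 3 y) :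
    phi9 D a b c x = phi9 D a b c y := by
  have h1 := phi9_Idl D a b c ((Submodule.Quotient.eq _).1 h)
  rwa [LinearMap.mem_ker, map_sub, sub_eq_zero] at h1

theorem exists9 (z : TP K H 2) : ∃ (n : ℕ) (u v : Fin n → H),
    z = ∑ i, tt9 K (u i) (v i) := by
  induction z using ind9_two with
  | h0 => exact ⟨0, Fin.elim0, Fin.elim0, by simp⟩
  | ht x y => exact ⟨1, fun _ => x, fun _ => y, by simp⟩
  | ha x y hx hy =>
  obtain ⟨n, u, v, rfl⟩ := hx
  obtain ⟨m, u', v', rfl⟩ := hy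
  refine ⟨n + m, Fin.append u u', Fin.append v v', ?_⟩
  rw [Fin.sum_univ_add]
  simp only [Fin.append_left, Fin.append_right]

theorem mul9_act (D : HopfAlgebroid K H R α β) (h : H) (s : TP K H 2)
    (hs : qtMk K H (fun a => α a) (fun a => β a) 2 s = D.Δ h) (a b : R) :
    D.hAct h (a * b) = mu9 D a b s := by
  obtain ⟨n, u, v, rfl⟩ := exists9 s
  have h1 := D.Δ_bimod_left a 1 1 D.Δ_one.symm
  rw [mul_one, mul_one] at h1
  have h2 := D.Δ_mul h (α a) _ _ hs h1.symm
  have h3 : (∑ i, tt9 K (u i) (v i)) * slotP K H 2 0 (α a)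
      = ∑ i, tt9 K (u i * α a) (v i) := by
    rw [Finset.sum_mul]
    refine Finset.sum_congr rfl fun i _ => ?_
    rw [slot9_20, mul9_two, mul_one]
  rw [h3] at h2
  have h4 := D.counit_left _ n (fun i => u i * α a) v h2.symm
  have h5 : D.hAct h (a * b) = D.ε ((h * α a) * α b) := by
    rw [HopfAlgebroid.hAct, map_mul α, mul_assoc]
  rw [h5, ← h4, Finset.sum_mul, map_sum, map_sum]
  refine Finset.sum_congr rfl fun i _ => ?_
  rw [mu9_tmul, mul_assoc, D.ε_bimod_left]
  rfl

theorem mu9_mul (D : HopfAlgebroid K H R α β) (a b : R) (x y : H) (z : TP K H 2) :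
    mu9 D a b (z * tt9 K x y) = mu9 D (D.hAct x a) (D.hAct y b) z := by
  induction z using ind9_two with
  | h0 => simp only [zero_mul, map_zero]
  | ha x y hx hy => rw [add_mul, map_add, map_add, hx, hy]
  | ht x y => rw [mul9_two, mu9_tmul, mu9_tmul, aux9_act_mul, aux9_act_mul]

theorem phi9_mul (D : HopfAlgebroid K H R α β) (a b c : R) (x y w : H) (z : TP K H 3) :
    phi9 D a b c (z * ttt9 (tt9 K x y) w)
      = phi9 D (D.hAct x a) (D.hAct y b) (D.hAct w c) z := by
  induction z using ind9_three with
  | h0 => simp only [zero_mul, map_zero]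
  | ha x y hx hy => rw [add_mul, map_add, map_add, hx, hy]
  | ht x y => rw [mul9_three, phi9_tmul, phi9_tmul, mu9_mul, aux9_act_mul]

theorem as9_zero (x : H) : as9 x (0 : TP K H 2) = 0 := by
  have h : (x ⊗ₜ[K] (0 : H ⊗[K] H)) = 0 := TensorProduct.tmul_zero _ _
  exact (congrArg (TensorProduct.assoc K H H H).symm h).trans (map_zero _)

theorem as9_add (x : H) (y z : TP K H 2) : as9 x (y + z) = as9 x y + as9 x z := by
  have h (y z : H ⊗[K] H) : (x ⊗ₜ[K] (y + z)) = x ⊗ₜ[K] y + x ⊗ₜ[K] z :=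
    TensorProduct.tmul_add _ _ _
  exact (congrArg (TensorProduct.assoc K H H H).symm (h y z)).trans (map_add _ _ _)

theorem as9_tt (x y z : H) : as9 x (tt9 K y z) = ttt9 (tt9 K x y) z := rfl

theorem phi9_assoc (D : HopfAlgebroid K H R α β) (a b c : R) (x : H) (z : TP K H 2) :
    phi9 D a b c (as9 x z) = D.hAct x a * mu9 D b c z := by
  induction z using ind9_two with
  | h0 => rw [as9_zero, map_zero, map_zero, mul_zero]
  | ha x y hx hy => rw [as9_add, map_add, map_add, hx, hy, mul_add]
  | ht x y => rw [as9_tt, phi9_tmul, mu9_tmul, mu9_tmul, mul_assoc]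

theorem starF9 (D : HopfAlgebroid K H R α β) {C : ℕ} (p q : Fin C → H) (a b : R) :
    starF D p q a b = mu9 D a b (∑ c, tt9 K (p c) (q c)) := by
  rw [map_sum]; rfl

end Aux9

/-- **The twisted base algebra `R_F` (Xu).**
Let `(H, α, β, ·, Δ, ε)` be a Hopf algebroid over `R` and suppose
`F = F₁ ⊗_R F₂ ∈ H ⊗_R H` (presented as `F = Σ_c (p c) ⊗_R (q c)`, with lifts `s c`,
`t c` of `Δ(p c)`, `Δ(q c)`) satisfies (T1)
`(Δ ⊗_R id)(F) · (F ⊗_R 1) = (id ⊗_R Δ)(F) · (1 ⊗_R F)` and (T2)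
`(ε ⊗_R id)F = (id ⊗_R ε)F = 1`.  Then `a ⋆_F b := (F₁ ▷ a)(F₂ ▷ b)` is well defined
(independent of the finite sum representing `F` in `H ⊗_R H`), and `R_F = (R, ⋆_F)` is an
associative `K`-algebra with unit `1`. -/
theorem twistorEqs_star_assoc
    (K : Type u) [Field K] [CharZero K]
    (H : Type u) [Ring H] [Algebra K H]
    (R : Type u) [Ring R] [Algebra K R]
    (α : R →ₐ[K] H) (β : R →ₗ[K] H)
    (D : HopfAlgebroid K H R α β)
    (C : ℕ) (p q : Fin C → H) (s t : Fin C → TP K H 2)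
    (hs : ∀ c, qtMk K H (fun a => α a) (fun a => β a) 2 (s c) = D.Δ (p c))
    (ht : ∀ c, qtMk K H (fun a => α a) (fun a => β a) 2 (t c) = D.Δ (q c))
    (hT1 : TwistorEq1 D p q s t) (hT2 : TwistorEq2 D p q) :
    -- well-definedness of `⋆_F`
    (∀ (C' : ℕ) (p' q' : Fin C' → H),
      qtMk K H (fun a => α a) (fun a => β a) 2 (∑ c, (p' c ⊗ₜ[K] q' c : TP K H 2)) =
        qtMk K H (fun a => α a) (fun a => β a) 2 (∑ c, (p c ⊗ₜ[K] q c : TP K H 2)) →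
      ∀ a b : R, starF D p' q' a b = starF D p q a b) ∧
    -- associativity of `⋆_F`
    (∀ a b c : R, starF D p q (starF D p q a b) c = starF D p q a (starF D p q b c)) ∧
    -- `1` is a unit for `⋆_F`
    (∀ a : R, starF D p q 1 a = a) ∧ (∀ a : R, starF D p q a 1 = a) := by
  refine ⟨fun C' p' q' h a b => ?_, fun a b c => ?_, fun a => ?_, fun a => ?_⟩
  · rw [starF9, starF9]
    exact mu9_congr D a b _ _ h
  · have h := phi9_congr D a b c _ _ hT1
    have hL : starF D p q (starF D p q a b) c = phi9 D a b c
      ((∑ c, ttt9 (s c) (q c)) * (∑ c, ttt9 (tt9 K (p c) (q c)) 1)) := by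
      rw [Finset.mul_sum, map_sum]
      simp only [phi9_mul, map_sum, aux9_act_one, phi9_tmul]
      rw [Finset.sum_comm]
      unfold starF
      refine Finset.sum_congr rfl fun i _ => ?_
      rw [aux9_act_sum, Finset.sum_mul]
      refine Finset.sum_congr rfl fun d _ => ?_
      rw [mul9_act D (p i) (s i) (hs i)]
    have hR : starF D p q a (starF D p q b c) = phi9 D a b c
      ((∑ c, as9 (p c) (t c)) * (∑ c, as9 1 (tt9 K (p c) (q c)))) := by
      rw [Finset.mul_sum, map_sum]
      simp only [as9_tt, phi9_mul, map_sum, aux9_act_one, phi9_assoc]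
      rw [Finset.sum_comm]
      unfold starF
      refine Finset.sum_congr rfl fun i _ => ?_
      rw [aux9_act_sum, Finset.mul_sum]
      refine Finset.sum_congr rfl fun d _ => ?_
      rw [mul9_act D (q i) (t i) (ht i)]
    exact hL.trans (h.trans hR.symm)
  · have h := congrArg (fun x => D.hAct x a) hT2.1
    simp only [aux9_act_one] at h
    rw [← act9_apply, map_sum] at h
    refine Eq.trans (Finset.sum_congr rfl fun i _ => ?_) h
    rw [act9_apply, aux9_act_α]
    simp only [HopfAlgebroid.hAct, map_one, mul_one]
  · have h := congrArg (fun x => D.hAct x a) hT2.2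
    simp only [aux9_act_one] at h
    rw [← act9_apply, map_sum] at h
    refine Eq.trans (Finset.sum_congr rfl fun i _ => ?_) h
    rw [act9_apply, aux9_act_β]
    simp only [HopfAlgebroid.hAct, map_one, mul_one]
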